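/- Let ψ be the trilinear form on 𝔰𝔩₃(ℂ) given by ψ(a,b,c) = tr((ab−ba)c). The ℂ-linear map from End_ℂ(𝔰𝔩₃(ℂ)) (which has dimension 64) to the space of alternating trilinear forms on 𝔰𝔩₃(ℂ) (which has dimension 56), sending an endomorphism X to the alternating trilinear form (a,b,c) ↦ ψ(Xa,b,c) + ψ(a,Xb,c) + ψ(a,b,Xc), is surjective. (Equivalently, the GL(𝔰𝔩₃(ℂ))-orbit of ψ inside Λ³(𝔰𝔩₃(ℂ))^∨ is open, i.e. ψ is a non-degenerate three-form in eight variables in the sense of Gurevich's classification.) -/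

import Mathlib

open Matrix

/-- The trilinear form `ψ(a,b,c) = tr((ab − ba)c)` on 3×3 complex matrices. -/
noncomputable def psi (a b c : Matrix (Fin 3) (Fin 3) ℂ) : ℂ :=
  ((a * b - b * a) * c).trace

/-- `𝔰𝔩₃(ℂ)`: the traceless 3×3 complex matrices. -/
noncomputable def sl3 : Submodule ℂ (Matrix (Fin 3) (Fin 3) ℂ) :=
  LinearMap.ker (Matrix.traceLinearMap (Fin 3) ℂ ℂ)

theorem psi_swap_left (a b c : Matrix (Fin 3) (Fin 3) ℂ) : psi a b c = -psi b a c := by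
  simp [psi, sub_mul]

theorem psi_rotate (a b c : Matrix (Fin 3) (Fin 3) ℂ) : psi a b c = psi b c a := by
  simp only [psi, sub_mul, trace_sub]
  rw [trace_mul_cycle b c a, trace_mul_cycle b a c]

theorem psi_swap_right (a b c : Matrix (Fin 3) (Fin 3) ℂ) : psi a b c = -psi a c b := by
  rw [psi_rotate, psi_swap_left, ← psi_rotate]

theorem psi_swap_outer (a b c : Matrix (Fin 3) (Fin 3) ℂ) : psi a b c = -psi c b a := by
  rw [psi_rotate, psi_swap_right, ← psi_rotate]

theorem psi_self_left (a b : Matrix (Fin 3) (Fin 3) ℂ) : psi a a b = 0 := by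
  simp [psi]

theorem psi_self_right (a b : Matrix (Fin 3) (Fin 3) ℂ) : psi a b b = 0 := by
  rw [psi_rotate, psi_self_left]

theorem psi_self_outer (a b : Matrix (Fin 3) (Fin 3) ℂ) : psi a b a = 0 := by
  rw [psi_rotate, psi_self_right]

/-- An alternating map is determined by its values on strictly increasing families of basis
vectors. -/
theorem Module.Basis.ext_alternating_strictMono {R M N ι : Type*} [CommRing R] [AddCommGroup M]
    [Module R M] [AddCommGroup N] [Module R N] [LinearOrder ι] {n : ℕ}
    {f g : M [⋀^Fin n]→ₗ[R] N} (e : Module.Basis ι R M)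
    (h : ∀ v : Fin n → ι, StrictMono v → (f fun i => e (v i)) = g fun i => e (v i)) : f = g := by
  refine e.ext_alternating fun v hv => ?_
  have hs := h (v ∘ Tuple.sort v)
    ((Tuple.monotone_sort v).strictMono_of_injective (hv.comp (Tuple.sort v).injective))
  have hf := f.map_perm (fun i => e (v i)) (Tuple.sort v)
  have hg := g.map_perm (fun i => e (v i)) (Tuple.sort v)
  simp only [Function.comp_def] at hs hf hg
  rw [hs, hg] at hf
  exact (smul_left_cancel _ hf).symm

namespace sl3

/-- The traceless matrix with coordinates `x`: the off-diagonal entries `(0,1)`, `(1,2)`, `(2,0)`,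
`(1,0)`, `(2,1)`, `(0,2)`, followed by the diagonal entries `(0,0)`, `(1,1)`. -/
def ofCoords (x : Fin 8 → ℂ) : Matrix (Fin 3) (Fin 3) ℂ :=
  !![x 6, x 0, x 5; x 3, x 7, x 1; x 2, x 4, -x 6 - x 7]

/-- The coordinates on `𝔰𝔩₃(ℂ)` inverse to `sl3.ofCoords`. -/
noncomputable def coords : sl3 ≃ₗ[ℂ] (Fin 8 → ℂ) where
  toFun a := ![a.1 0 1, a.1 1 2, a.1 2 0, a.1 1 0, a.1 2 1, a.1 0 2, a.1 0 0, a.1 1 1]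
  map_add' a b := by ext i; fin_cases i <;> rfl
  map_smul' r a := by ext i; fin_cases i <;> rfl
  invFun x := ⟨ofCoords x, by simp [sl3, ofCoords, trace_fin_three]⟩
  left_inv := by
    rintro ⟨a, ha⟩
    have ha' : a 0 0 + a 1 1 + a 2 2 = 0 := by
      simpa [sl3, trace_fin_three] using ha
    ext i j
    fin_cases i <;> fin_cases j <;> simp [ofCoords]
    linear_combination -ha'
  right_inv x := by ext i; fin_cases i <;> rfl

/-- The basis of `𝔰𝔩₃(ℂ)` consisting of six elementary matrices and of the diagonal matrices
`diag(1, 0, -1)` and `diag(0, 1, -1)`. -/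
noncomputable def basis : Module.Basis (Fin 8) ℂ sl3 :=
  Module.Basis.ofEquivFun coords

theorem coe_coords_symm (x : Fin 8 → ℂ) :
    (coords.symm x : Matrix (Fin 3) (Fin 3) ℂ) = ofCoords x :=
  rfl

theorem coe_basis (i : Fin 8) : (basis i : Matrix (Fin 3) (Fin 3) ℂ) =
    ofCoords (Pi.single i 1) := by
  simp [basis, coe_coords_symm]

theorem finrank_eq : Module.finrank ℂ sl3 = 8 := by
  simp [Module.finrank_eq_card_basis basis]

/-- The infinitesimal action of an endomorphism of `𝔰𝔩₃(ℂ)` on the three-form `ψ`. -/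
noncomputable def derivPsi (X : Module.End ℂ sl3) : sl3 [⋀^Fin 3]→ₗ[ℂ] ℂ :=
  { MultilinearMap.mk' (fun v : Fin 3 → sl3 =>
      psi (X (v 0)) (v 1) (v 2) + psi (v 0) (X (v 1)) (v 2) + psi (v 0) (v 1) (X (v 2)))
      (fun v i x y => by
        fin_cases i <;> simp [psi, add_mul, mul_add, sub_mul] <;> ring)
      (fun v i r x => by
        fin_cases i <;> simp [psi, sub_mul] <;> ring) with
    map_eq_zero_of_eq' := fun v i j hij hne => by
      change psi (X (v 0)) (v 1) (v 2) + psi (v 0) (X (v 1)) (v 2) +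
        psi (v 0) (v 1) (X (v 2)) = 0
      fin_cases i <;> fin_cases j <;> simp at hij hne
      all_goals simp only [hij]
      · linear_combination psi_swap_left (X (v 1)) (v 1) (v 2) + psi_self_left (v 1) (X (v 2))
      · linear_combination psi_swap_outer (X (v 2)) (v 1) (v 2) + psi_self_outer (v 2) (X (v 1))
      · linear_combination psi_swap_left (X (v 0)) (v 0) (v 2) + psi_self_left (v 0) (X (v 2))
      · linear_combination psi_swap_right (v 0) (X (v 2)) (v 2) + psi_self_right (X (v 0)) (v 2)
      · linear_combination psi_swap_outer (X (v 0)) (v 1) (v 0) + psi_self_outer (v 0) (X (v 1))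
      · linear_combination psi_swap_right (v 0) (X (v 1)) (v 1) + psi_self_right (X (v 0)) (v 1) }

/-- The coordinates of the images of the basis vectors under an endomorphism `X` with
`derivPsi X = T`, where `t i j k` is the value of `T` on the basis vectors with indices `i`, `j`,
`k`. -/
noncomputable def preimageCoords (t : Fin 8 → Fin 8 → Fin 8 → ℂ) : Fin 8 → Fin 8 → ℂ
  | 0 => ![(t 0 1 2 + t 0 3 6 - t 0 3 7 + t 1 4 6 - t 1 4 7 + t 2 5 6 - t 2 5 7) / 3, (t 0 4 6 +
    t 0 4 7) / 3, (-t 0 5 6 - t 0 5 7) / 3, -t 0 4 5, (-t 0 1 6 - t 0 1 7 + t 5 6 7) / 3,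
    (t 0 2 6 + t 0 2 7 + t 4 6 7) / 3, (-3 * t 0 1 4 - 6 * t 0 2 5 - 5 * t 0 6 7 - 4 * t 4 5 6 +
    5 * t 4 5 7) / 9, (6 * t 0 1 4 + 3 * t 0 2 5 + 4 * t 0 6 7 + 5 * t 4 5 6 - 4 * t 4 5 7) / 9]
  | 1 => ![(2 * t 1 3 6 - t 1 3 7) / 3, (t 0 1 2 + t 0 3 7 + t 1 4 7 + t 2 5 7) / 3,
    (-2 * t 1 5 6 + t 1 5 7) / 3, (2 * t 0 1 6 - t 0 1 7 - 2 * t 5 6 7) / 3, t 1 3 5,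
    (2 * t 1 2 6 - t 1 2 7 + t 3 6 7) / 3, (-3 * t 0 1 3 - 3 * t 1 2 5 + t 1 6 7 - 2 * t 3 5 6 +
    t 3 5 7) / 9, (6 * t 0 1 3 - 3 * t 1 2 5 + 4 * t 1 6 7 + t 3 5 6 + 4 * t 3 5 7) / 9]
  | 2 => ![(t 2 3 6 - 2 * t 2 3 7) / 3, (-t 2 4 6 + 2 * t 2 4 7) / 3, (t 0 1 2 - t 0 3 6 -
    t 1 4 6 - t 2 5 6) / 3, (t 0 2 6 - 2 * t 0 2 7 - 2 * t 4 6 7) / 3, (-t 1 2 6 + 2 * t 1 2 7 -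
    2 * t 3 6 7) / 3, -t 2 3 4, (-6 * t 0 2 3 - 3 * t 1 2 4 + 4 * t 2 6 7 - 4 * t 3 4 6 -
    t 3 4 7) / 9, (3 * t 0 2 3 - 3 * t 1 2 4 + t 2 6 7 - t 3 4 6 + 2 * t 3 4 7) / 9]
  | 3 => ![t 1 2 3, (-t 2 6 7 + t 3 4 6 + t 3 4 7) / 3, (-t 1 6 7 - t 3 5 6 - t 3 5 7) / 3,
    -t 3 4 5 / 3, (t 1 3 6 + t 1 3 7) / 3, (-t 2 3 6 - t 2 3 7) / 3, (4 * t 1 2 6 - 5 * t 1 2 7 +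
    3 * t 1 3 4 + 6 * t 2 3 5 + 5 * t 3 6 7) / 9, (-5 * t 1 2 6 + 4 * t 1 2 7 - 6 * t 1 3 4 -
    3 * t 2 3 5 - 4 * t 3 6 7) / 9]
  | 4 => ![(2 * t 2 6 7 - 2 * t 3 4 6 + t 3 4 7) / 3, -t 0 2 4, (-t 0 6 7 - 2 * t 4 5 6 +
    t 4 5 7) / 3, (2 * t 0 4 6 - t 0 4 7) / 3, -t 3 4 5 / 3, (-2 * t 2 4 6 + t 2 4 7) / 3,
    (2 * t 0 2 6 - t 0 2 7 + 3 * t 0 3 4 + 3 * t 2 4 5 - t 4 6 7) / 9, (-t 0 2 6 - 4 * t 0 2 7 -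
    6 * t 0 3 4 + 3 * t 2 4 5 - 4 * t 4 6 7) / 9]
  | 5 => ![(2 * t 1 6 7 - t 3 5 6 + 2 * t 3 5 7) / 3, (2 * t 0 6 7 + t 4 5 6 - 2 * t 4 5 7) / 3,
    t 0 1 5, (t 0 5 6 - 2 * t 0 5 7) / 3, (-t 1 5 6 + 2 * t 1 5 7) / 3, -t 3 4 5 / 3,
    (4 * t 0 1 6 + t 0 1 7 + 6 * t 0 3 5 + 3 * t 1 4 5 - 4 * t 5 6 7) / 9, (t 0 1 6 -
    2 * t 0 1 7 - 3 * t 0 3 5 + 3 * t 1 4 5 - t 5 6 7) / 9]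
  | 6 => ![0, 0, t 5 6 7, 0, 0, -t 2 6 7, (-3 * t 0 1 2 + 4 * t 0 3 6 + t 0 3 7 + t 1 4 6 +
    t 1 4 7 - 2 * t 2 5 6 + t 2 5 7 + 3 * t 3 4 5) / 9, (-2 * t 0 3 6 - 2 * t 0 3 7 +
    4 * t 1 4 6 - 2 * t 1 4 7 + t 2 5 6 - 2 * t 2 5 7) / 9]
  | 7 => ![t 3 6 7, t 4 6 7, 0, -t 0 6 7, -t 1 6 7, 0, (2 * t 0 3 6 + 2 * t 0 3 7 + 2 * t 1 4 6 -
    t 1 4 7 + 2 * t 2 5 6 - 4 * t 2 5 7) / 9, (-3 * t 0 1 2 - t 0 3 6 - 4 * t 0 3 7 - t 1 4 6 +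
    2 * t 1 4 7 - t 2 5 6 - t 2 5 7 + 3 * t 3 4 5) / 9]

set_option maxHeartbeats 4000000 in
theorem psi_preimageCoords (t : Fin 8 → Fin 8 → Fin 8 → ℂ) {i j k : Fin 8}
    (hij : i < j) (hjk : j < k) :
    psi (ofCoords (preimageCoords t i)) (ofCoords (Pi.single j 1))
        (ofCoords (Pi.single k 1)) +
      psi (ofCoords (Pi.single i 1)) (ofCoords (preimageCoords t j))
        (ofCoords (Pi.single k 1)) +
      psi (ofCoords (Pi.single i 1)) (ofCoords (Pi.single j 1))
        (ofCoords (preimageCoords t k)) = t i j k := by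
  fin_cases i <;> fin_cases j <;> first | (exfalso; revert hij; decide) | skip
  all_goals fin_cases k <;> first | (exfalso; revert hjk; decide) | skip
  all_goals
    simp [psi, ofCoords, preimageCoords, trace_fin_three]
    try ring

theorem derivPsi_surjective : Function.Surjective derivPsi := fun T => by
  let t i j k := T ![basis i, basis j, basis k]
  obtain ⟨X, hX⟩ : ∃ X : Module.End ℂ sl3,
      ∀ i, (X (basis i) : Matrix (Fin 3) (Fin 3) ℂ) = ofCoords (preimageCoords t i) :=
    ⟨basis.constr ℂ fun i => coords.symm (preimageCoords t i), fun i => by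
      rw [Module.Basis.constr_basis, coe_coords_symm]⟩
  refine ⟨X, basis.ext_alternating_strictMono fun v hv => ?_⟩
  have hT : (T fun i => basis (v i)) = t (v 0) (v 1) (v 2) :=
    congrArg T (by ext i; fin_cases i <;> rfl)
  rw [hT, ← psi_preimageCoords t (hv (by decide : (0 : Fin 3) < 1))
    (hv (by decide : (1 : Fin 3) < 2))]
  simp only [← coe_basis, ← hX]
  rfl

end sl3

set_option maxSynthPendingDepth 3 in
set_option synthInstance.maxHeartbeats 1000000 in
/-- The linear map `End(𝔰𝔩₃) → Λ³(𝔰𝔩₃)^∨`, `X ↦ ((a,b,c) ↦ ψ(Xa,b,c) + ψ(a,Xb,c) + ψ(a,b,Xc))`,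
from the 64-dimensional space of endomorphisms of `𝔰𝔩₃(ℂ)` to the 56-dimensional space of
alternating trilinear forms on `𝔰𝔩₃(ℂ)`, is surjective; i.e. the `GL₈`-orbit of ψ is open. -/
theorem surjective_onto_alternating_forms :
    Module.finrank ℂ (Module.End ℂ ↥sl3) = 64 ∧
    Module.finrank ℂ (AlternatingMap ℂ ↥sl3 ℂ (Fin 3)) = 56 ∧
    ∀ T : AlternatingMap ℂ ↥sl3 ℂ (Fin 3), ∃ X : Module.End ℂ ↥sl3,
      ∀ a b c : ↥sl3,
        T ![a, b, c] = psi ↑(X a) ↑b ↑c + psi ↑a ↑(X b) ↑c + psi ↑a ↑b ↑(X c) := by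
  have : Module.Finite ℂ sl3 := .of_basis sl3.basis
  have : Module.Free ℂ sl3 := .of_basis sl3.basis
  refine ⟨?_, ?_, fun T => ?_⟩
  · rw [Module.finrank_linearMap, sl3.finrank_eq]
  · rw [exteriorPower.alternatingMapLinearEquiv.finrank_eq, Module.finrank_linearMap,
      exteriorPower.finrank_eq, sl3.finrank_eq, Module.finrank_self]
    rfl
  · obtain ⟨X, rfl⟩ := sl3.derivPsi_surjective T
    exact ⟨X, fun a b c => rfl⟩
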